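/- arXiv:2110.05191 — 4 statements merged into one kernel-verified Lean document; each statement's English description precedes it below -/
import Mathlib

section
/- For every natural number n and all real numbers x, y, one has Ψ(xy, -x² - y², n) · (x + y)^{δ(n)} = x^n + y^n; in particular, when x + y ≠ 0, Ψ(xy, -x² - y², n) = (x^n + y^n)/(x + y)^{δ(n)}. -/
/-- The `Ψ` sequence over the reals: `Ψ a b 0 = 2`, `Ψ a b 1 = 1`, and
`Ψ a b (m+2) = (2a-b)^(δ(m+1)) * Ψ a b (m+1) - a * Ψ a b m`. -/
def psiR (a b : ℝ) : ℕ → ℝ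
  | 0 => 2
  | 1 => 1
  | m + 2 => (2 * a - b) ^ ((m + 1) % 2) * psiR a b (m + 1) - a * psiR a b m

theorem psiR_aux (x y : ℝ) (n : ℕ) :
    psiR (x * y) (-x ^ 2 - y ^ 2) n * (x + y) ^ (n % 2) = x ^ n + y ^ n := by
  induction n using Nat.twoStepInduction with
  | zero => norm_num [psiR]
  | one => norm_num [psiR]
  | more m h0 h1 =>
    rw [psiR]
    rcases Nat.mod_two_eq_zero_or_one m with h | h
    · have e1 : (m + 1) % 2 = 1 := by omega
      have e2 : (m + 2) % 2 = 0 := by omega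
      rw [h] at h0
      rw [e1] at h1
      rw [e1, e2]
      linear_combination (x + y) * h1 - x * y * h0
    · have e1 : (m + 1) % 2 = 0 := by omega
      have e2 : (m + 2) % 2 = 1 := by omega
      rw [h] at h0
      rw [e1] at h1
      rw [e1, e2]
      linear_combination (x + y) * h1 - x * y * h0

theorem psi_representation_sums_of_powers
    (n : ℕ) (x y : ℝ) :
    psiR (x * y) (-x ^ 2 - y ^ 2) n * (x + y) ^ (n % 2) = x ^ n + y ^ n ∧
    (x + y ≠ 0 →
      psiR (x * y) (-x ^ 2 - y ^ 2) n = (x ^ n + y ^ n) / (x + y) ^ (n % 2)) := by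
  exact ⟨psiR_aux x y n, fun h => (eq_div_iff (pow_ne_zero _ h)).2 (psiR_aux x y n)⟩
end

section
/- Let k ≥ 2 and let p_k and p_{k+1} denote the k-th and (k+1)-st prime numbers. Then for all integers α, β, the prime p_{k+1} divides Ω_0(p_k | α, β | 2p_k) in ℤ. -/
/-- The Omega sequence `Ω_r(k | ζ, ξ | n)`: `Ω_r(0) = 1` and
`Ω_r(k+1) = (2ζ-ξ)(n-r-(k+1))·Ω_r(k) - 2ζ(n-2r-δ(n-1))·Ω_{r+1}(k)`. -/
def omegaZ (ζ ξ : ℤ) (n : ℕ) : ℕ → ℕ → ℤ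
  | _, 0 => 1
  | r, k + 1 =>
    (2 * ζ - ξ) * ((n : ℤ) - r - (k + 1)) * omegaZ ζ ξ n r k
      - 2 * ζ * ((n : ℤ) - 2 * r - ((n - 1) % 2 : ℕ)) * omegaZ ζ ξ n (r + 1) k

lemma omega_aux (ζ ξ : ℤ) (n : ℕ) (D : ℤ) (k : ℕ) : ∀ (r : ℕ) (X : ℤ),
    (∀ j ≤ k, D ∣ (∏ i ∈ Finset.range j, ((n : ℤ) - 2 * r - ((n - 1) % 2 : ℕ) - 2 * i)) *
      (∏ i ∈ Finset.range (k - j), ((n : ℤ) - r - k + i)) * X) →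
    D ∣ X * omegaZ ζ ξ n r k := by
  induction k with
  | zero =>
    intro r X h
    have := h 0 le_rfl
    simpa [omegaZ] using this
  | succ k ih =>
    intro r X h
    have h1 : D ∣ (((n : ℤ) - r - (k + 1)) * X) * omegaZ ζ ξ n r k := by
      apply ih
      intro j hj
      have := h j (by omega)
      rw [show k + 1 - j = (k - j) + 1 by omega, Finset.prod_range_succ'] at this
      convert this using 1
      have e : ∀ i : ℕ, (n : ℤ) - r - ((k + 1 : ℕ) : ℤ) + ((i + 1 : ℕ) : ℤ) = n - r - k + i := by
        intro i; push_cast; ring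
      simp only [e]
      push_cast
      ring
    have h2 : D ∣ (((n : ℤ) - 2 * r - ((n - 1) % 2 : ℕ)) * X) * omegaZ ζ ξ n (r + 1) k := by
      apply ih
      intro j hj
      have := h (j + 1) (by omega)
      rw [show k + 1 - (j + 1) = k - j by omega, Finset.prod_range_succ'] at this
      convert this using 1
      have e : ∀ i : ℕ, (n : ℤ) - r - ((k + 1 : ℕ) : ℤ) + i = n - ((r + 1 : ℕ) : ℤ) - k + i := by
        intro i; push_cast; ring
      have e' : ∀ i : ℕ, (n : ℤ) - 2 * r - ((n - 1) % 2 : ℕ) - 2 * ((i + 1 : ℕ) : ℤ)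
          = n - 2 * ((r + 1 : ℕ) : ℤ) - ((n - 1) % 2 : ℕ) - 2 * i := by
        intro i; push_cast; ring
      simp only [e, e']
      push_cast
      ring
    have := dvd_sub (h1.mul_left (2 * ζ - ξ)) (h2.mul_left (2 * ζ))
    have e : omegaZ ζ ξ n r (k + 1) = (2 * ζ - ξ) * ((n : ℤ) - r - (k + 1)) * omegaZ ζ ξ n r k
      - 2 * ζ * ((n : ℤ) - 2 * r - ((n - 1) % 2 : ℕ)) * omegaZ ζ ξ n (r + 1) k := by
      rw [omegaZ]
    rw [e]
    refine dvd_trans this (dvd_of_eq ?_)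
    ring

lemma omega_odd (α β : ℤ) (p q : ℕ) (h1 : p ≤ q) (h2 : q < 2 * p) (hq : q % 2 = 1) :
    (q : ℤ) ∣ omegaZ α β (2 * p) 0 p := by
  rw [← one_mul (omegaZ _ _ _ _ _)]
  apply omega_aux
  intro j hj
  rw [mul_one]
  by_cases hjq : j < 2 * p - q
  · apply Dvd.dvd.mul_left
    refine dvd_trans (dvd_of_eq ?_)
      (Finset.dvd_prod_of_mem _ (Finset.mem_range.2 (show q - p < p - j by omega)))
    push_cast [h1]
    ring
  · apply Dvd.dvd.mul_right
    refine dvd_trans (dvd_of_eq ?_)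
      (Finset.dvd_prod_of_mem _ (Finset.mem_range.2 (show (2 * p - 1 - q) / 2 < j by omega)))
    omega

theorem omega_next_prime_divides
    (k : ℕ) (hk : 2 ≤ k) (α β : ℤ) :
    ((Nat.nth Nat.Prime k : ℤ)) ∣
      omegaZ α β (2 * Nat.nth Nat.Prime (k - 1)) 0 (Nat.nth Nat.Prime (k - 1)) := by
  have hinf := Nat.infinite_setOfPred_prime
  have hp : (Nat.nth Nat.Prime (k - 1)).Prime := Nat.nth_mem_of_infinite hinf _
  have hq : (Nat.nth Nat.Prime k).Prime := Nat.nth_mem_of_infinite hinf _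
  have hlt : Nat.nth Nat.Prime (k - 1) < Nat.nth Nat.Prime k :=
    Nat.nth_strictMono hinf (by omega)
  have hp2 := hp.two_le
  have hodd : Nat.nth Nat.Prime k % 2 = 1 := by
    rcases hq.eq_two_or_odd with h | h
    · omega
    · exact h
  obtain ⟨r, hr, hr1, hr2⟩ := Nat.exists_prime_lt_and_le_two_mul _ hp.ne_zero
  have hle : Nat.nth Nat.Prime k ≤ r := by
    by_contra! hc
    have h3 : k = (k - 1) + 1 := by omega
    rw [h3] at hc
    exact absurd (Nat.le_nth_of_lt_nth_succ hc hr) (by omega)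
  exact omega_odd α β _ _ hlt.le (by omega) hodd
end

section
/- Let k ≥ 2, let p_k and p_{k+1} denote the k-th and (k+1)-st prime numbers, and let α, β be integers with Ψ(α, β, 2p_k) ≠ 0. Then Ψ(α, β, 2p_k) divides Ω_0(p_k | α, β | 2p_k) in ℤ, and moreover p_{k+1} divides the integer quotient Ω_0(p_k | α, β | 2p_k) / Ψ(α, β, 2p_k); equivalently, p_{k+1} · Ψ(α, β, 2p_k) divides Ω_0(p_k | α, β | 2p_k). -/
/-- The `Ψ` sequence: `Ψ a b 0 = 2`, `Ψ a b 1 = 1`, and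
`Ψ a b (m+2) = (2a-b)^(δ(m+1)) * Ψ a b (m+1) - a * Ψ a b m`. -/
def psiZ (a b : ℤ) : ℕ → ℤ
  | 0 => 2
  | 1 => 1
  | m + 2 => (2 * a - b) ^ ((m + 1) % 2) * psiZ a b (m + 1) - a * psiZ a b m

def TT : ℕ → ℕ → ℕ
  | 0, 0 => 2
  | 0, _ + 1 => 0
  | 1, 0 => 1
  | 1, _ + 1 => 0
  | n + 2, 0 => TT (n + 1) 0
  | n + 2, j + 1 => TT (n + 1) (j + 1) + TT n j

lemma TT_zero : ∀ n j : ℕ, n < 2 * j → TT n j = 0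
  | 0, 0, h => by omega
  | 0, _ + 1, _ => by simp [TT]
  | 1, 0, h => by omega
  | 1, _ + 1, _ => by simp [TT]
  | n + 2, 0, h => by omega
  | n + 2, j + 1, h => by
    rw [TT, TT_zero (n + 1) (j + 1) (by omega), TT_zero n j (by omega)]

lemma TT_succ_zero (n : ℕ) : TT (n + 1) 0 = 1 := by
  induction n with
  | zero => simp [TT]
  | succ n ih => rw [TT, ih]

lemma TT_diag (j : ℕ) : TT (2 * j) j = 2 := by
  induction j with
  | zero => simp [TT]
  | succ j ih =>
    rw [show 2 * (j + 1) = 2 * j + 2 by ring, TT, ih, TT_zero _ _ (by omega)]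

lemma TT_closed : ∀ s j d : ℕ, j + d = s + 1 →
    j.factorial * d.factorial * TT (2 * j + d) j = (2 * j + d) * s.factorial := by
  intro s
  induction s with
  | zero =>
    intro j d h
    rcases j with _ | j
    · obtain rfl : d = 1 := by omega
      simp [TT]
    · obtain rfl : j = 0 := by omega
      obtain rfl : d = 0 := by omega
      simp [TT]
  | succ s ih =>
    intro j d h
    rcases j with _ | j
    · obtain rfl : d = s + 2 := by omega
      simp [TT_succ_zero, Nat.factorial_succ]
    · rcases d with _ | d
      · obtain rfl : j = s + 1 := by omega
        rw [add_zero, TT_diag]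
        simp [Nat.factorial_succ]; ring
      · have h1 := ih (j + 1) d (by omega)
        have h2 := ih j (d + 1) (by omega)
        rw [show 2 * (j + 1) + (d + 1) = (2 * j + d + 1) + 2 by ring, TT]
        rw [show 2 * (j + 1) + d = 2 * j + d + 1 + 1 by ring] at h1
        rw [show 2 * j + (d + 1) = 2 * j + d + 1 by ring] at h2
        obtain rfl : s = j + d := by omega
        rw [Nat.factorial_succ] at h1 h2
        rw [Nat.factorial_succ j, Nat.factorial_succ d, Nat.factorial_succ (j + d)]
        linear_combination (d + 1) * h1 + (j + 1) * h2

lemma psi_formula (a b : ℤ) : ∀ n N : ℕ, n / 2 < N →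
    psiZ a b n = ∑ j ∈ Finset.range N, (-a) ^ j * (2 * a - b) ^ (n / 2 - j) * (TT n j : ℤ)
  | 0, N, h => by
    obtain ⟨N, rfl⟩ : ∃ M, N = M + 1 := ⟨N - 1, by omega⟩
    rw [Finset.sum_range_succ']
    simp [TT, psiZ]
  | 1, N, h => by
    obtain ⟨N, rfl⟩ : ∃ M, N = M + 1 := ⟨N - 1, by omega⟩
    rw [Finset.sum_range_succ']
    simp [TT, psiZ]
  | n + 2, N, h => by
    obtain ⟨N, rfl⟩ : ∃ M, N = M + 1 := ⟨N - 1, by omega⟩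
    rw [psiZ, psi_formula a b (n + 1) (N + 1) (by omega), psi_formula a b n N (by omega)]
    have key : ∀ j, (2 * a - b) ^ ((n + 1) % 2) *
        ((-a) ^ j * (2 * a - b) ^ ((n + 1) / 2 - j) * (TT (n + 1) j : ℤ))
        = (-a) ^ j * (2 * a - b) ^ ((n + 2) / 2 - j) * (TT (n + 1) j : ℤ) := by
      intro j
      by_cases hj : n + 1 < 2 * j
      · simp [TT_zero _ _ hj]
      · rw [show (n + 2) / 2 - j = (n + 1) % 2 + ((n + 1) / 2 - j) by omega, pow_add]
        ring
    rw [Finset.mul_sum, Finset.sum_congr rfl (fun j _ => key j), Finset.sum_range_succ',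
      Finset.sum_range_succ' _ N, Finset.mul_sum]
    rw [add_sub_right_comm, ← Finset.sum_sub_distrib]
    congr 1
    apply Finset.sum_congr rfl
    intro j _
    rw [TT, show (n + 2) / 2 - (j + 1) = n / 2 - j by omega]
    push_cast
    ring

lemma omega_formula (a b : ℤ) (n : ℕ) (hn : (n - 1) % 2 = 1) (k : ℕ) : ∀ r : ℕ,
    omegaZ a b n r k = ∑ ij ∈ Finset.HasAntidiagonal.antidiagonal k, (k.choose ij.1 : ℤ) *
      ((2 * a - b) ^ ij.2 * (-2 * a) ^ ij.1 *
        (∏ t ∈ Finset.range ij.1, ((n : ℤ) - 2 * r - 1 - 2 * t)) *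
        ∏ t ∈ Finset.range ij.2, ((n : ℤ) - r - ij.1 - 1 - t)) := by
  induction k with
  | zero => intro r; simp [omegaZ]
  | succ k ih =>
    intro r
    rw [Finset.sum_antidiagonal_choose_succ_mul (fun i j => ((2 * a - b) ^ j * (-2 * a) ^ i *
        (∏ t ∈ Finset.range i, ((n : ℤ) - 2 * r - 1 - 2 * t)) *
        ∏ t ∈ Finset.range j, ((n : ℤ) - r - i - 1 - t)))]
    rw [omegaZ, ih r, ih (r + 1), hn, sub_eq_add_neg, Finset.mul_sum, Finset.mul_sum,
      ← Finset.sum_neg_distrib]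
    congr 1
    · apply Finset.sum_congr rfl
      rintro ⟨i, j⟩ hij
      rw [Finset.HasAntidiagonal.mem_antidiagonal] at hij
      simp only at hij
      subst hij
      simp only [Finset.prod_range_succ]
      push_cast
      ring
    · apply Finset.sum_congr rfl
      rintro ⟨i, j⟩ hij
      rw [Finset.HasAntidiagonal.mem_antidiagonal] at hij
      simp only at hij
      subst hij
      rw [← Nat.choose_symm_add]
      simp only [Finset.prod_range_succ' _ i]
      have e1 : ∏ t ∈ Finset.range i, ((n : ℤ) - 2 * r - 1 - 2 * ((t + 1 : ℕ) : ℤ))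
          = ∏ t ∈ Finset.range i, ((n : ℤ) - 2 * ((r + 1 : ℕ) : ℤ) - 1 - 2 * t) :=
        Finset.prod_congr rfl (fun t _ => by push_cast; ring)
      have e2 : ∏ t ∈ Finset.range j, ((n : ℤ) - r - ((i + 1 : ℕ) : ℤ) - 1 - t)
          = ∏ t ∈ Finset.range j, ((n : ℤ) - ((r + 1 : ℕ) : ℤ) - i - 1 - t) :=
        Finset.prod_congr rfl (fun t _ => by push_cast; ring)
      rw [e1, e2]
      push_cast
      ring

lemma prodQ (s : ℕ) : ∀ e : ℕ,
    (∏ t ∈ Finset.range e, (((s + e : ℕ) : ℤ) - t)) * (s.factorial : ℤ) = ((s + e).factorial : ℤ) := by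
  intro e
  induction e with
  | zero => simp
  | succ e ih =>
    rw [Finset.prod_range_succ', ← add_assoc, Nat.factorial_succ]
    push_cast at ih ⊢
    rw [← ih]
    have : ∏ t ∈ Finset.range e, ((s : ℤ) + e + 1 - (t + 1)) =
      ∏ t ∈ Finset.range e, ((s : ℤ) + e - t) := Finset.prod_congr rfl (fun t _ => by ring)
    rw [this]; ring

lemma prodP (e : ℕ) : ∀ j : ℕ,
    (∏ t ∈ Finset.range j, (((2 * (j + e) : ℕ) : ℤ) - 1 - 2 * t)) * 2 ^ j * ((j + e).factorial : ℤ)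
      * ((2 * e).factorial : ℤ) = ((2 * (j + e)).factorial : ℤ) * e.factorial := by
  intro j
  induction j with
  | zero => simp; ring
  | succ j ih =>
    rw [Finset.prod_range_succ', show 2 * (j + 1 + e) = 2 * (j + e) + 1 + 1 by ring,
      show j + 1 + e = (j + e) + 1 by ring, Nat.factorial_succ (j + e),
      Nat.factorial_succ, Nat.factorial_succ]
    have : ∏ t ∈ Finset.range j, (((2 * (j + e) + 1 + 1 : ℕ) : ℤ) - 1 - 2 * ((t + 1 : ℕ) : ℤ)) =
      ∏ t ∈ Finset.range j, (((2 * (j + e) : ℕ) : ℤ) - 1 - 2 * t) :=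
        Finset.prod_congr rfl (fun t _ => by push_cast; ring)
    rw [this]
    push_cast at ih ⊢
    linear_combination (2 * ((j : ℤ) + e) + 1) * (2 * (j + e) + 2) * ih

lemma coef_eq (j e s : ℕ) (hs : j + e = s + 1) :
    ((j + e).choose j : ℤ) * 2 ^ j *
      (∏ t ∈ Finset.range j, (((2 * (j + e) : ℕ) : ℤ) - 1 - 2 * t)) *
      (∏ t ∈ Finset.range e, (((s + e : ℕ) : ℤ) - t))
    = ((2 * s + 1).descFactorial (s + 1) : ℤ) * (TT (2 * (j + e)) j : ℤ) := by
  have hQ := prodQ s e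
  have hP := prodP e j
  have hC : ((j + e).choose j : ℤ) * j.factorial * e.factorial = (j + e).factorial := by
    rw [Nat.choose_symm_add]; exact_mod_cast Nat.add_choose_mul_factorial_mul_factorial j e
  have hT : (j.factorial : ℤ) * (2 * e).factorial * TT (2 * (j + e)) j
      = (2 * (j + e)) * (s + e).factorial := by
    have := TT_closed (s + e) j (2 * e) (by omega)
    rw [← mul_add] at this
    exact_mod_cast this
  have hD : (s.factorial : ℤ) * (2 * s + 1).descFactorial (s + 1) = (2 * s + 1).factorial := by
    have := Nat.factorial_mul_descFactorial (n := 2 * s + 1) (k := s + 1) (by omega)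
    rw [show 2 * s + 1 - (s + 1) = s by omega] at this
    exact_mod_cast this
  have hF : ((2 * (j + e)).factorial : ℤ) = (2 * (j + e)) * (2 * s + 1).factorial := by
    rw [hs, show 2 * (s + 1) = 2 * s + 1 + 1 by ring, Nat.factorial_succ]
    have : (j : ℤ) + e = s + 1 := by exact_mod_cast hs
    rw [this]; push_cast; ring
  rw [hF] at hP
  generalize (∏ t ∈ Finset.range j, (((2 * (j + e) : ℕ) : ℤ) - 1 - 2 * t)) = P at *
  generalize (∏ t ∈ Finset.range e, (((s + e : ℕ) : ℤ) - t)) = Q at *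
  have n1 : (j.factorial : ℤ) ≠ 0 := by exact_mod_cast j.factorial_ne_zero
  have n2 : (e.factorial : ℤ) ≠ 0 := by exact_mod_cast e.factorial_ne_zero
  have n3 : (s.factorial : ℤ) ≠ 0 := by exact_mod_cast s.factorial_ne_zero
  have n4 : ((2 * e).factorial : ℤ) ≠ 0 := by exact_mod_cast (2 * e).factorial_ne_zero
  apply mul_left_cancel₀ (mul_ne_zero (mul_ne_zero n1 n2) (mul_ne_zero n3 n4))
  generalize (j.factorial : ℤ) = J at *
  generalize (e.factorial : ℤ) = E at *
  generalize (s.factorial : ℤ) = S at *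
  generalize ((2 * e).factorial : ℤ) = E2 at *
  generalize ((j + e).factorial : ℤ) = M at *
  generalize ((s + e).factorial : ℤ) = SE at *
  generalize ((2 * s + 1).factorial : ℤ) = F at *
  generalize ((j + e).choose j : ℤ) = C at *
  generalize (((2 * s + 1).descFactorial (s + 1) : ℕ) : ℤ) = D at *
  generalize (TT (2 * (j + e)) j : ℤ) = T at *
  generalize (2 : ℤ) ^ j = X at *
  calc J * E * (S * E2) * (C * X * P * Q) = (C * J * E) * X * P * (Q * S) * E2 := by ring
    _ = (P * X * M * E2) * SE := by rw [hC, hQ]; ring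
    _ = E * F * (2 * (j + e) * SE) := by rw [hP]; ring
    _ = _ := by rw [← hT, ← hD]; ring

lemma omega_eq (a b : ℤ) (s : ℕ) : omegaZ a b (2 * (s + 1)) 0 (s + 1) =
    ((2 * s + 1).descFactorial (s + 1) : ℤ) * psiZ a b (2 * (s + 1)) := by
  rw [omega_formula a b _ (by omega), psi_formula a b _ (s + 2) (by omega), Finset.mul_sum,
    Finset.Nat.sum_antidiagonal_eq_sum_range_succ_mk]
  apply Finset.sum_congr rfl
  intro j hj
  rw [Finset.mem_range] at hj
  obtain ⟨e, he⟩ : ∃ e, j + e = s + 1 := ⟨s + 1 - j, by omega⟩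
  have h := coef_eq j e s he
  rw [he] at h
  rw [show s + 1 - j = e by omega, show 2 * (s + 1) / 2 - j = e by omega]
  have e1 : ∏ t ∈ Finset.range e, (((2 * (s + 1) : ℕ) : ℤ) - ((0 : ℕ) : ℤ) - j - 1 - t) =
      ∏ t ∈ Finset.range e, (((s + e : ℕ) : ℤ) - t) := by
    apply Finset.prod_congr rfl
    intro t _
    have : (j : ℤ) + e = s + 1 := by exact_mod_cast he
    push_cast
    linarith
  simp only
  rw [e1, show (-2 * a) ^ j = 2 ^ j * (-a) ^ j by rw [← mul_pow]; ring]
  simp only [Nat.cast_zero, mul_zero, sub_zero]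
  linear_combination (2 * a - b) ^ e * (-a) ^ j * h

lemma next_prime_dvd (k : ℕ) (hk : 2 ≤ k) (s : ℕ) (hs : Nat.nth Nat.Prime (k - 1) = s + 1) :
    Nat.nth Nat.Prime k ∣ (2 * s + 1).descFactorial (s + 1) := by
  have hinf := Nat.infinite_setOfPred_prime
  have hq : (Nat.nth Nat.Prime k).Prime := Nat.prime_nth_prime k
  have hlt : Nat.nth Nat.Prime (k - 1) < Nat.nth Nat.Prime k :=
    Nat.nth_strictMono hinf (by omega)
  have hle : Nat.nth Nat.Prime k ≤ 2 * (s + 1) := by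
    obtain ⟨p, hp, h1, h2⟩ := Nat.exists_prime_lt_and_le_two_mul (s + 1) (by omega)
    refine le_trans ?_ h2
    by_contra! hc
    have := Nat.lt_nth_iff_count_lt hinf (p := Nat.Prime) (a := p) (b := k)
    have hh : Nat.nth Nat.Prime (Nat.count Nat.Prime p) = p := Nat.nth_count hp
    rw [← hh] at hc
    rw [← hs, ← hh] at h1
    have c1 := (Nat.nth_lt_nth hinf).1 hc
    have c2 := (Nat.nth_lt_nth hinf).1 h1
    omega
  have hpos : 0 < s := by
    have : Nat.nth Nat.Prime 0 < Nat.nth Nat.Prime (k - 1) :=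
      Nat.nth_strictMono hinf (by omega)
    have := (Nat.prime_nth_prime 0).two_le
    omega
  have hne : Nat.nth Nat.Prime k ≠ 2 * (s + 1) := by
    intro h
    have : Even (Nat.nth Nat.Prime k) := by rw [h]; exact even_two_mul _
    have := (Nat.Prime.even_iff hq).1 this
    omega
  have hD := Nat.factorial_mul_descFactorial (n := 2 * s + 1) (k := s + 1) (by omega)
  rw [show 2 * s + 1 - (s + 1) = s by omega] at hD
  have : Nat.nth Nat.Prime k ∣ (2 * s + 1).factorial := (hq.dvd_factorial).2 (by omega)
  rw [← hD] at this
  rcases hq.dvd_mul.1 this with h | h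
  · have := hq.dvd_factorial.1 h
    omega
  · exact h

theorem omega_second_fundamental
    (k : ℕ) (hk : 2 ≤ k) (α β : ℤ)
    (hpsi : psiZ α β (2 * Nat.nth Nat.Prime (k - 1)) ≠ 0) :
    psiZ α β (2 * Nat.nth Nat.Prime (k - 1)) ∣
      omegaZ α β (2 * Nat.nth Nat.Prime (k - 1)) 0 (Nat.nth Nat.Prime (k - 1)) ∧
    ((Nat.nth Nat.Prime k : ℤ)) ∣
      omegaZ α β (2 * Nat.nth Nat.Prime (k - 1)) 0 (Nat.nth Nat.Prime (k - 1)) /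
        psiZ α β (2 * Nat.nth Nat.Prime (k - 1)) ∧
    (Nat.nth Nat.Prime k : ℤ) * psiZ α β (2 * Nat.nth Nat.Prime (k - 1)) ∣
      omegaZ α β (2 * Nat.nth Nat.Prime (k - 1)) 0 (Nat.nth Nat.Prime (k - 1)) := by
  obtain ⟨s, hs⟩ : ∃ s, Nat.nth Nat.Prime (k - 1) = s + 1 :=
    ⟨Nat.nth Nat.Prime (k - 1) - 1, by
      have := (Nat.prime_nth_prime (k - 1)).pos
      omega⟩
  have hd := next_prime_dvd k hk s hs
  rw [hs] at hpsi ⊢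
  have hd' : (Nat.nth Nat.Prime k : ℤ) ∣ ((2 * s + 1).descFactorial (s + 1) : ℤ) := by
    exact_mod_cast hd
  rw [omega_eq]
  refine ⟨Dvd.intro_left _ rfl, ?_, mul_dvd_mul_right hd' _⟩
  rw [Int.mul_ediv_cancel _ hpsi]
  exact hd'
end

section
/- Let p ≥ 5 be a prime and set n = 2^{p-1}. Then 2^p - 1 is prime if and only if 2n - 1 divides Ψ(1, 4, n) in ℤ. -/
theorem psi_even_odd (k : ℕ) :
    psiZ 1 4 (2*k+2) = -2 * psiZ 1 4 (2*k+1) - psiZ 1 4 (2*k) ∧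
    psiZ 1 4 (2*k+3) = psiZ 1 4 (2*k+2) - psiZ 1 4 (2*k+1) := by
  constructor
  · rw [psiZ, show (2*k+1) % 2 = 1 by omega]; ring
  · rw [psiZ, show (2*k+1+1) % 2 = 0 by omega]; ring

theorem psi_rec (k : ℕ) :
    psiZ 1 4 (2*(k+2)) = -4 * psiZ 1 4 (2*(k+1)) - psiZ 1 4 (2*k) := by
  have h1 := psi_even_odd k
  have h2 := (psi_even_odd (k+1)).1
  simp only [Nat.mul_add, Nat.reduceMul, Nat.add_assoc, Nat.reduceAdd] at h1 h2 ⊢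
  linarith [h1.1, h1.2]

theorem psi_inv (k : ℕ) (e : ℕ → ℤ) (h0 : e 0 = 2) (h1 : e 1 = -4)
    (hr : ∀ k, e (k+2) = -4 * e (k+1) - e k) :
    e (2*k) = e k ^ 2 - 2 ∧ e (2*k+1) = e k * e (k+1) + 4 ∧
    e k ^ 2 + e (k+1) ^ 2 + 4 * e k * e (k+1) = -12 := by
  induction k with
  | zero => simp [h0, h1]
  | succ k ih =>
    obtain ⟨a, b, c⟩ := ih
    have r1 := hr (2*k)
    have r2 := hr (2*k+1)
    have r3 := hr k
    have e1 : e (2*(k+1)) = e (k+1) ^ 2 - 2 := by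
      rw [show 2*(k+1) = 2*k+2 by ring, r1, a, b]; linarith
    refine ⟨e1, ?_, ?_⟩
    · rw [show 2*(k+1) = 2*k+2 by ring] at e1
      rw [show 2*(k+1)+1 = 2*k+1+2 by ring, r2, show 2*k+1+1 = 2*k+2 by ring, e1, b,
        show k+1+1 = k+2 by ring, r3]; ring
    · rw [show k+1+1 = k+2 by ring, r3]; linarith

theorem psi_eq_s (i : ℕ) : psiZ 1 4 (2 ^ (i+2)) = LucasLehmer.s (i+1) := by
  have key := fun k => (psi_inv k (fun k => psiZ 1 4 (2*k)) (by simp [psiZ]) (by norm_num [psiZ])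
    psi_rec).1
  induction i with
  | zero => norm_num [psiZ, LucasLehmer.s]
  | succ i ih =>
    have := key (2^(i+1))
    rw [show 2*2^(i+1) = 2^(i+2) by ring, ih, show 2*2^(i+2) = 2^(i+1+2) by ring] at this
    exact this


theorem lucas_lehmer_moustafa_psi
    (p : ℕ) (hp : p.Prime) (hp5 : 5 ≤ p) (n : ℕ) (hn : n = 2 ^ (p - 1)) :
    Nat.Prime (2 ^ p - 1) ↔ (2 * (n : ℤ) - 1) ∣ psiZ 1 4 n := by
  obtain ⟨m, rfl⟩ : ∃ m, p = m + 3 := ⟨p - 3, by omega⟩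
  have hd : (2 * (n : ℤ) - 1) ∣ psiZ 1 4 n ↔ LucasLehmer.LucasLehmerTest (m + 3) := by
    subst hn
    rw [show m + 3 - 1 = m + 2 by omega, psi_eq_s, LucasLehmer.LucasLehmerTest,
      LucasLehmer.lucasLehmerResidue, LucasLehmer.sZMod_eq_s (m+1),
      show m + 1 + 2 - 2 = m + 1 by omega]
    have : (2 * ((2 ^ (m+2) : ℕ) : ℤ) - 1) = ((2 ^ (m+3) - 1 : ℕ) : ℤ) := by
      rw [Nat.cast_sub Nat.one_le_two_pow]; push_cast; ring
    rw [this]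
    exact (ZMod.intCast_zmod_eq_zero_iff_dvd _ _).symm
  rw [hd]
  exact ⟨fun h => lucas_lehmer_necessity _ (by omega) h,
    fun h => lucas_lehmer_sufficiency _ (by omega) h⟩
end
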